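/- arXiv:1404.0099 — 8 statements merged into one kernel-verified Lean document; each statement's English description precedes it below -/
import Mathlib

section
/- Let α be a type and g : List α → α → ℝ a conditional weight function, and define the sequential density of a list l by D(l) = ∏_{k < l.length} g(l.take k, l[k]). Assume D is invariant under permutation, i.e. D(l) = D(l') whenever l and l' are permutations of each other. Then for any two lists s₁ and s₂ that are permutations of each other with D(s₁) ≠ 0, and any lists t₁ and t₂, the ratio of total densities factors through the suffix weights only: D(s₁ ++ t₁) / D(s₂ ++ t₂) = (∏_{k < t₁.length} g((s₁ ++ t₁).take (s₁.length + k), t₁[k])) / (∏_{k < t₂.length} g((s₂ ++ t₂).take (s₂.length + k), t₂[k])). -/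
/-- The sequential density of a list `l` under a conditional weight function `g`:
the product over positions `k` of the weight of the `k`-th element given the
history of the previous elements. -/
noncomputable def seqDensity {α : Type*} (g : List α → α → ℝ) (l : List α) : ℝ :=
  ∏ k : Fin l.length, g (l.take (k : ℕ)) (l.get k)

/-- The sequential density of a concatenation is the density of the prefix times the
conditional weights of the suffix. -/
theorem seqDensity_append {α : Type*} (g : List α → α → ℝ) (s t : List α) :
    seqDensity g (s ++ t) = seqDensity g s *
      ∏ k : Fin t.length, g ((s ++ t).take (s.length + (k : ℕ))) (t.get k) := by
  unfold seqDensity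
  rw [← (finCongr (List.length_append (as := s) (bs := t)).symm).prod_comp, Fin.prod_univ_add]
  congr 1
  · refine Finset.prod_congr rfl fun k _ => ?_
    simp [List.take_append_of_le_length k.isLt.le]
  · refine Finset.prod_congr rfl fun k _ => ?_
    simp

/-- Factorization of the ratio of sequential densities: if the sequential density is
invariant under permutation, then for prefixes `s₁ ~ s₂` with nonzero density, the ratio
of the densities of `s₁ ++ t₁` and `s₂ ++ t₂` factors through the suffix weights only. -/
theorem seqDensity_append_ratio {α : Type*} (g : List α → α → ℝ)
    (hinv : ∀ l l' : List α, l.Perm l' → seqDensity g l = seqDensity g l')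
    (s₁ s₂ t₁ t₂ : List α) (hperm : s₁.Perm s₂) (hne : seqDensity g s₁ ≠ 0) :
    seqDensity g (s₁ ++ t₁) / seqDensity g (s₂ ++ t₂) =
      (∏ k : Fin t₁.length, g ((s₁ ++ t₁).take (s₁.length + (k : ℕ))) (t₁.get k)) /
      (∏ k : Fin t₂.length, g ((s₂ ++ t₂).take (s₂.length + (k : ℕ))) (t₂.get k)) := by
  rw [seqDensity_append, seqDensity_append, ← hinv s₁ s₂ hperm, mul_div_mul_left _ _ hne]
end

section
/- Let α be a type with decidable equality, s a multiset over α, and a, b ∈ s. Then (∏_{γ ∈ s.toFinset} ((s.erase a).count γ)!) * ((s.erase b).count a) = (∏_{γ ∈ s.toFinset} ((s.erase b).count γ)!) * ((s.erase a).count b). -/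
/-- Restoring the erased copy of `a` multiplies the product of the factorials of the multiplicities
by the multiplicity of `a`. -/
theorem Multiset.prod_factorial_count_erase_mul_count {α : Type*} [DecidableEq α]
    {s : Multiset α} {a : α} (ha : a ∈ s) :
    (∏ γ ∈ s.toFinset, Nat.factorial ((s.erase a).count γ)) * s.count a =
      ∏ γ ∈ s.toFinset, Nat.factorial (s.count γ) := by
  have ha' : a ∈ s.toFinset := Multiset.mem_toFinset.mpr ha
  have hrest : ∏ γ ∈ s.toFinset.erase a, Nat.factorial ((s.erase a).count γ) =
      ∏ γ ∈ s.toFinset.erase a, Nat.factorial (s.count γ) :=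
    Finset.prod_congr rfl fun γ hγ => by
      rw [Multiset.count_erase_of_ne (Finset.ne_of_mem_erase hγ)]
  rw [← Finset.mul_prod_erase _ _ ha', ← Finset.mul_prod_erase _ _ ha', hrest,
    Multiset.count_erase_self, mul_right_comm, mul_comm (Nat.factorial _),
    Nat.mul_factorial_pred (Multiset.count_pos.mpr ha).ne']

/-- Combinatorial core of the claim about the ratio `P(Υ | ξ_j)/P(Υ | ξ_i)`:
for a multiset `s` of particles and `a, b ∈ s`,
`(∏_{γ ∈ s.toFinset} nds(γ,a)!) * nds(a,b) = (∏_{γ ∈ s.toFinset} nds(γ,b)!) * nds(b,a)`,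
where `nds(γ,c) = (s.erase c).count γ` is the number of duplicates of `γ` in `s \ {c}`. -/
theorem multiset_erase_factorial_count {α : Type*} [DecidableEq α]
    (s : Multiset α) (a b : α) (ha : a ∈ s) (hb : b ∈ s) :
    (∏ γ ∈ s.toFinset, Nat.factorial ((s.erase a).count γ)) * ((s.erase b).count a) =
    (∏ γ ∈ s.toFinset, Nat.factorial ((s.erase b).count γ)) * ((s.erase a).count b) := by
  rcases eq_or_ne a b with rfl | hab
  · rfl
  · rw [Multiset.count_erase_of_ne hab, Multiset.count_erase_of_ne hab.symm,
      Multiset.prod_factorial_count_erase_mul_count ha,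
      Multiset.prod_factorial_count_erase_mul_count hb]
end

section
/- Let α be a type with decidable equality, s a multiset over α with a, b ∈ s, and κ : α → ℝ. For c ∈ s define the particle-set generation probability P(s ∣ c) = (((s.card − 1)! : ℝ) / ∏_{γ ∈ s.toFinset} (((s.erase c).count γ)! : ℝ)) * ∏_{γ ∈ s.erase c} κ(γ), where the last product is taken over the multiset s.erase c with multiplicity. Then P(s ∣ b) * ((s.erase b).count a) * (∏_{γ ∈ s.erase a} κ(γ)) = P(s ∣ a) * ((s.erase a).count b) * (∏_{γ ∈ s.erase b} κ(γ)). Equivalently, when all quantities are nonzero, P(s ∣ b)/P(s ∣ a) = (((s.erase a).count b)/((s.erase b).count a)) * (∏_{γ ∈ s.erase b} κ(γ))/(∏_{γ ∈ s.erase a} κ(γ)). -/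
/-- The probability `P(s ∣ c)` of generating the multiset `s` of particles starting from
the particle `c ∈ s`, by drawing the remaining `s.card − 1` particles independently from a
simulation kernel with density `κ`: the product of the `κ`-densities of the other particles
multiplied by the number of distinct orders in which they could have been drawn. -/
noncomputable def genProb {α : Type*} [DecidableEq α] (κ : α → ℝ) (s : Multiset α)
    (c : α) : ℝ :=
  ((Nat.factorial (s.card - 1) : ℝ) /
      ∏ γ ∈ s.toFinset, (Nat.factorial ((s.erase c).count γ) : ℝ)) *
    ((s.erase c).map κ).prod

/-- Erasing one copy of `c` divides the product of the factorials of the multiplicities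
by the multiplicity of `c`. -/
theorem Multiset.count_mul_prod_factorial_count_erase {α : Type*} [DecidableEq α]
    {s : Multiset α} {c : α} (hc : c ∈ s) :
    s.count c * ∏ γ ∈ s.toFinset, ((s.erase c).count γ).factorial =
      ∏ γ ∈ s.toFinset, (s.count γ).factorial := by
  have hc' : c ∈ s.toFinset := Multiset.mem_toFinset.2 hc
  rw [← Finset.mul_prod_erase _ _ hc', ← Finset.mul_prod_erase _ _ hc', ← mul_assoc,
    Multiset.count_erase_self, Nat.mul_factorial_pred (Multiset.count_pos.2 hc).ne']
  congr 1
  refine Finset.prod_congr rfl fun γ hγ => ?_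
  rw [Multiset.count_erase_of_ne (Finset.ne_of_mem_erase hγ)]

/-- The generation probability in terms of the multiplicities in `s` itself. -/
theorem genProb_eq {α : Type*} [DecidableEq α] (κ : α → ℝ) {s : Multiset α} {c : α}
    (hc : c ∈ s) :
    genProb κ s c =
      (Nat.factorial (s.card - 1) : ℝ) * s.count c /
        (∏ γ ∈ s.toFinset, (Nat.factorial (s.count γ) : ℝ)) * ((s.erase c).map κ).prod := by
  have h : (s.count c : ℝ) * ∏ γ ∈ s.toFinset, (Nat.factorial ((s.erase c).count γ) : ℝ) =
      ∏ γ ∈ s.toFinset, (Nat.factorial (s.count γ) : ℝ) := by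
    exact_mod_cast Multiset.count_mul_prod_factorial_count_erase hc
  have hcount : (s.count c : ℝ) ≠ 0 := Nat.cast_ne_zero.2 (Multiset.count_pos.2 hc).ne'
  rw [genProb, ← h, mul_comm (s.count c : ℝ), mul_div_mul_right _ _ hcount]

/-- The claim about the ratio of particle-set generation probabilities:
`P(s ∣ b) * nds(a,b) * ∏_{γ ∈ s.erase a} κ γ = P(s ∣ a) * nds(b,a) * ∏_{γ ∈ s.erase b} κ γ`,
i.e. `P(s ∣ b)/P(s ∣ a) = (nds(b,a)/nds(a,b)) * (∏_{γ ∈ s.erase b} κ γ)/(∏_{γ ∈ s.erase a} κ γ)`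
when all quantities are nonzero. -/
theorem genProb_ratio {α : Type*} [DecidableEq α] (κ : α → ℝ) (s : Multiset α)
    (a b : α) (ha : a ∈ s) (hb : b ∈ s) :
    genProb κ s b * (((s.erase b).count a : ℝ)) * ((s.erase a).map κ).prod =
    genProb κ s a * (((s.erase a).count b : ℝ)) * ((s.erase b).map κ).prod := by
  rcases eq_or_ne a b with rfl | hab
  · rfl
  · rw [genProb_eq κ ha, genProb_eq κ hb, Multiset.count_erase_of_ne hab,
      Multiset.count_erase_of_ne hab.symm]
    ring
end

section
/- Let α be a type with decidable equality, s a multiset over α, and p, κ : α → ℝ with p(γ) > 0 and κ(γ) > 0 for every γ ∈ s. Define the particle weights w(γ) = p(γ)/κ(γ) and, for c ∈ s, the leave-one-out total weight W₋c = Σ_{γ ∈ s.erase c} w(γ) (sum with multiplicity). Then for a ∈ s and b ∈ s.erase a, (p(b) * (((s.erase b).count a) * w(a) / W₋b) * ((s.erase a).count b) * ∏_{γ ∈ s.erase b} κ(γ)) / (p(a) * (((s.erase a).count b) * w(b) / W₋a) * ((s.erase b).count a) * ∏_{γ ∈ s.erase a} κ(γ)) = W₋a / W₋b. -/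
/-- The Metropolis–Hastings acceptance factor for the `MH_n` particle kernel collapses to
the ratio of leave-one-out total weights `W₋a / W₋b`.  Here `s` is the multiset of
particles, `p γ` is the posterior density of particle `γ`, `κ γ` its simulation-kernel
density, `w γ = p γ / κ γ` its weight, `W₋c = Σ_{γ ∈ s.erase c} w γ` the leave-one-out
total weight, and `(s.erase c).count γ` the duplicate count `nds(γ, c)`. -/
theorem mh_n_acceptance_factor {α : Type*} [DecidableEq α] (s : Multiset α)
    (p κ : α → ℝ) (hp : ∀ γ ∈ s, 0 < p γ) (hκ : ∀ γ ∈ s, 0 < κ γ)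
    (a : α) (ha : a ∈ s) (b : α) (hb : b ∈ s.erase a) :
    (p b * ((((s.erase b).count a : ℝ)) * (p a / κ a) /
          ((s.erase b).map (fun γ => p γ / κ γ)).sum) *
        (((s.erase a).count b : ℝ)) * ((s.erase b).map κ).prod) /
    (p a * ((((s.erase a).count b : ℝ)) * (p b / κ b) /
          ((s.erase a).map (fun γ => p γ / κ γ)).sum) *
        (((s.erase b).count a : ℝ)) * ((s.erase a).map κ).prod) =
    ((s.erase a).map (fun γ => p γ / κ γ)).sum /
      ((s.erase b).map (fun γ => p γ / κ γ)).sum := by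
  have hbs : b ∈ s := Multiset.mem_of_mem_erase hb
  have hab : a ∈ s.erase b := by
    rcases eq_or_ne a b with rfl | hne
    · exact hb
    · exact (Multiset.mem_erase_of_ne hne).2 ha
  have hprod : κ b * ((s.erase b).map κ).prod = κ a * ((s.erase a).map κ).prod := by
    rw [Multiset.prod_map_erase hbs, Multiset.prod_map_erase ha]
  have hPa : ((s.erase a).map κ).prod ≠ 0 := by
    refine Multiset.prod_ne_zero fun h => ?_
    obtain ⟨γ, hγ, h0⟩ := Multiset.mem_map.1 h
    exact (hκ γ (Multiset.mem_of_mem_erase hγ)).ne' h0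
  have hna : ((s.erase b).count a : ℝ) ≠ 0 :=
    Nat.cast_ne_zero.2 (Multiset.count_pos.2 hab).ne'
  have hnb : ((s.erase a).count b : ℝ) ≠ 0 :=
    Nat.cast_ne_zero.2 (Multiset.count_pos.2 hb).ne'
  have hpa := (hp a ha).ne'
  have hpb := (hp b hbs).ne'
  have hκa := (hκ a ha).ne'
  have hκb := (hκ b hbs).ne'
  have hPb : ((s.erase b).map κ).prod = κ a * ((s.erase a).map κ).prod / κ b := by
    rw [← hprod, mul_div_cancel_left₀ _ hκb]
  rw [hPb]
  generalize ((s.erase a).map fun γ => p γ / κ γ).sum = Wa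
  generalize ((s.erase b).map fun γ => p γ / κ γ).sum = Wb
  field_simp
end

section
/- Let ι be a finite type with at least two elements, and let p, K : ι → ℝ with p(k) > 0 and K(k) > 0 for all k. Define w(k) = p(k)/K(k) and W₋i = Σ_{k ≠ i} w(k). Then for all i ≠ j, (p(j) * (w(i) / W₋j) * ∏_{k ≠ j} K(k)) / (p(i) * (w(j) / W₋i) * ∏_{k ≠ i} K(k)) = W₋i / W₋j. -/
/-- The Metropolis–Hastings acceptance factor for enumerative Gibbs:
with candidate particles indexed by a finite type `ι` with at least two elements,
kernel densities `K k`, posterior densities `p k`, weights `w k = p k / K k` and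
leave-one-out totals `W₋i = Σ_{k ≠ i} w k`, the α-factor reduces to `W₋i / W₋j`. -/
theorem enumerative_gibbs_acceptance_factor {ι : Type*} [Fintype ι] [DecidableEq ι]
    (hcard : 2 ≤ Fintype.card ι) (p K : ι → ℝ)
    (hp : ∀ k, 0 < p k) (hK : ∀ k, 0 < K k) (i j : ι) (hij : i ≠ j) :
    (p j * ((p i / K i) / ∑ k ∈ Finset.univ.erase j, p k / K k) *
        ∏ k ∈ Finset.univ.erase j, K k) /
    (p i * ((p j / K j) / ∑ k ∈ Finset.univ.erase i, p k / K k) *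
        ∏ k ∈ Finset.univ.erase i, K k) =
    (∑ k ∈ Finset.univ.erase i, p k / K k) / (∑ k ∈ Finset.univ.erase j, p k / K k) := by
  have hprod : ∀ a, ∏ k ∈ Finset.univ.erase a, K k = (∏ k, K k) / K a := fun a => by
    rw [eq_div_iff (hK a).ne', Finset.prod_erase_mul _ _ (Finset.mem_univ a)]
  have hsum : ∀ a b, b ≠ a → 0 < ∑ k ∈ Finset.univ.erase a, p k / K k := fun a b hb =>
    Finset.sum_pos (fun k _ => div_pos (hp k) (hK k))
      ⟨b, Finset.mem_erase.mpr ⟨hb, Finset.mem_univ b⟩⟩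
  have hWi := (hsum i j hij.symm).ne'
  have hWj := (hsum j i hij).ne'
  have hP : ∏ k, K k ≠ 0 := Finset.prod_ne_zero_iff.mpr fun k _ => (hK k).ne'
  have hpi := (hp i).ne'
  have hpj := (hp j).ne'
  have hKi := (hK i).ne'
  have hKj := (hK j).ne'
  rw [hprod i, hprod j]
  generalize ∑ k ∈ Finset.univ.erase i, p k / K k = Wi at *
  generalize ∑ k ∈ Finset.univ.erase j, p k / K k = Wj at *
  generalize ∏ k, K k = P at *
  field_simp
end

section
/- Let Ω and I be types with I finite. Let P : Ω → ℝ, Pf : Ω → I → ℝ, K : I → Ω → Ω → ℝ, and α : I → Ω → Ω → ℝ, and suppose each indexed kernel satisfies detailed balance with respect to P in the sense that for all i, ρ, ξ: P(ρ) * K i ρ ξ * α i ρ ξ = P(ξ) * K i ξ ρ * α i ξ ρ. Define λ i ρ ξ = α i ρ ξ * Pf ξ i. Then for all ρ, ξ: P(ρ) * Σ_{i ∈ I} Pf ρ i * K i ρ ξ * λ i ρ ξ = P(ξ) * Σ_{i ∈ I} Pf ξ i * K i ξ ρ * λ i ξ ρ. -/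
/-- Detailed balance for the MixMH state-dependent mixture of kernels: if each indexed
kernel `K i` with acceptance factor `α i` satisfies detailed balance with respect to the
target density `P`, then with `λ i ρ ξ = α i ρ ξ * Pf ξ i` the index-averaged kernel
satisfies detailed balance with respect to `P`, where `Pf ρ i` is the probability of
selecting kernel index `i` in state `ρ`. -/
theorem mixmh_detailed_balance {Ω I : Type*} [Fintype I]
    (P : Ω → ℝ) (Pf : Ω → I → ℝ) (K : I → Ω → Ω → ℝ) (α : I → Ω → Ω → ℝ)
    (hdb : ∀ i ρ ξ, P ρ * K i ρ ξ * α i ρ ξ = P ξ * K i ξ ρ * α i ξ ρ)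
    (ρ ξ : Ω) :
    P ρ * ∑ i, Pf ρ i * K i ρ ξ * (α i ρ ξ * Pf ξ i) =
    P ξ * ∑ i, Pf ξ i * K i ξ ρ * (α i ξ ρ * Pf ρ i) := by
  rw [Finset.mul_sum, Finset.mul_sum]
  refine Finset.sum_congr rfl fun i _ => ?_
  linear_combination Pf ρ i * Pf ξ i * hdb i ρ ξ
end

section
/- Let Ω and I be types with I finite, and let P : Ω → ℝ, Pf : Ω → I → ℝ, and K : I → Ω → Ω → ℝ, all nonnegative. Define the transition density T(ρ, ξ) = Σ_{i ∈ I} Pf ρ i * K i ρ ξ * min 1 ((Pf ξ i * P ξ * K i ξ ρ) / (Pf ρ i * P ρ * K i ρ ξ)), where division by zero is taken to be zero. Then for all ρ, ξ: P(ρ) * T(ρ, ξ) = P(ξ) * T(ξ, ρ). -/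
theorem mul_min_one_div_eq_min {a b : ℝ} (ha : 0 ≤ a) (hb : 0 ≤ b) :
    a * min 1 (b / a) = min a b := by
  rcases ha.eq_or_lt with rfl | ha
  · simp [hb]
  · have ha_ne : a ≠ 0 := ne_of_gt ha
    rw [mul_min_of_nonneg _ _ ha.le, mul_one, mul_div_cancel₀ _ ha_ne]

/-- Detailed balance of the MixMH transition operator with the Metropolis–Hastings
acceptance rule: with probability `Pf ρ i` a kernel index `i` is selected in state `ρ`,
a proposal `ξ` is drawn with density `K i ρ ξ`, and it is accepted with probability
`min 1 ((Pf ξ i * P ξ * K i ξ ρ) / (Pf ρ i * P ρ * K i ρ ξ))` (division by zero being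
zero, as in Lean's real division).  The resulting transition density `T` satisfies
`P ρ * T ρ ξ = P ξ * T ξ ρ`. -/
theorem mixmh_transition_detailed_balance {Ω I : Type*} [Fintype I]
    (P : Ω → ℝ) (Pf : Ω → I → ℝ) (K : I → Ω → Ω → ℝ)
    (hP : ∀ ρ, 0 ≤ P ρ) (hPf : ∀ ρ i, 0 ≤ Pf ρ i) (hK : ∀ i ρ ξ, 0 ≤ K i ρ ξ)
    (T : Ω → Ω → ℝ)
    (hT : ∀ ρ ξ, T ρ ξ = ∑ i, Pf ρ i * K i ρ ξ *
        min 1 ((Pf ξ i * P ξ * K i ξ ρ) / (Pf ρ i * P ρ * K i ρ ξ)))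
    (ρ ξ : Ω) :
    P ρ * T ρ ξ = P ξ * T ξ ρ := by
  have flux (ρ ξ : Ω) :
      P ρ * T ρ ξ = ∑ i, min (Pf ρ i * P ρ * K i ρ ξ) (Pf ξ i * P ξ * K i ξ ρ) := by
    rw [hT, Finset.mul_sum]
    refine Finset.sum_congr rfl fun i _ => ?_
    rw [← mul_min_one_div_eq_min
      (mul_nonneg (mul_nonneg (hPf ρ i) (hP ρ)) (hK i ρ ξ))
      (mul_nonneg (mul_nonneg (hPf ξ i) (hP ξ)) (hK i ξ ρ))]
    ring
  simp only [flux, min_comm]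
end

section
/- Let α be a finite type, Q : ℝ → α → ℝ with Q θ x > 0 for all θ and x, each θ ↦ Q θ x differentiable, and Σ_{x ∈ α} Q θ x = 1 for every θ; let P : α → ℝ with P x > 0 for all x. Then for every θ: deriv (fun θ' => Σ_{x ∈ α} Q θ' x * Real.log (Q θ' x / P x)) θ = Σ_{x ∈ α} Q θ x * deriv (fun θ' => Real.log (Q θ' x)) θ * Real.log (Q θ x / P x). -/
/-- Gradient of the stochastic variational objective
`f(θ) = E_{x ∼ Q θ}[log (Q θ x / P x)]` for a positive probability mass function `Q θ`
on a finite sample space depending differentiably on the real parameter `θ` and a fixed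
positive target density `P`:
`∇_θ f(θ) = E_{x ∼ Q θ}[∇_θ log (Q θ x) * log (Q θ x / P x)]`. -/
theorem variational_objective_gradient {α : Type*} [Fintype α] (Q : ℝ → α → ℝ)
    (hpos : ∀ θ x, 0 < Q θ x)
    (hdiff : ∀ x, Differentiable ℝ (fun θ => Q θ x))
    (hnorm : ∀ θ, ∑ x, Q θ x = 1)
    (P : α → ℝ) (hP : ∀ x, 0 < P x) (θ : ℝ) :
    deriv (fun θ' => ∑ x, Q θ' x * Real.log (Q θ' x / P x)) θ =
      ∑ x, Q θ x * deriv (fun θ' => Real.log (Q θ' x)) θ * Real.log (Q θ x / P x) := by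
  have hQ : ∀ x, HasDerivAt (fun θ' => Q θ' x) (deriv (fun θ' => Q θ' x) θ) θ :=
    fun x => (hdiff x θ).hasDerivAt
  have hsum : ∑ x, deriv (fun θ' => Q θ' x) θ = 0 := by
    have h : HasDerivAt (fun θ' => ∑ x, Q θ' x) (∑ x, deriv (fun θ' => Q θ' x) θ) θ :=
      HasDerivAt.fun_sum fun x _ => hQ x
    simp only [hnorm] at h
    exact h.unique (hasDerivAt_const θ 1)
  have hterm : ∀ x, HasDerivAt (fun θ' => Q θ' x * Real.log (Q θ' x / P x))
      (deriv (fun θ' => Q θ' x) θ * Real.log (Q θ x / P x) + deriv (fun θ' => Q θ' x) θ) θ := by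
    intro x
    have hq := (hpos θ x).ne'
    have hp := (hP x).ne'
    refine ((hQ x).fun_mul (((hQ x).div_const (P x)).log (div_ne_zero hq hp))).congr_deriv ?_
    field_simp
  rw [(HasDerivAt.fun_sum fun x _ => hterm x).deriv, Finset.sum_add_distrib, hsum, add_zero]
  refine Finset.sum_congr rfl fun x _ => ?_
  rw [((hQ x).log (hpos θ x).ne').deriv, mul_div_cancel₀ _ (hpos θ x).ne']
end
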